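/- Let R(q) = (q,q^4;q^5)_∞/(q^2,q^3;q^5)_∞ and E(q)=(q;q)_∞. Then R(q^4)/(R(q)^2 R(q^2)) + R(q)^2 R(q^2)/R(q^4) = 2 + 4q^2 E(q^2) E(q^{20})^5/(E(q^4) E(q^{10})^5). -/

import Mathlib

/-- Euler's product E(q) = ∏_{k≥0} (1 - q^{k+1}). -/
noncomputable def E (q : ℂ) : ℂ := ∏' k : ℕ, (1 - q ^ (k + 1))

/-- q-Pochhammer infinite product (a;q)_∞ = ∏_{k≥0} (1 - a q^k). -/
noncomputable def qp (a q : ℂ) : ℂ := ∏' k : ℕ, (1 - a * q ^ k)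

/-- Rogers–Ramanujan function G(q) = 1/((q,q^4;q^5)_∞). -/
noncomputable def G (q : ℂ) : ℂ := 1 / (qp q (q ^ 5) * qp (q ^ 4) (q ^ 5))

/-- Rogers–Ramanujan function H(q) = 1/((q^2,q^3;q^5)_∞). -/
noncomputable def H (q : ℂ) : ℂ := 1 / (qp (q ^ 2) (q ^ 5) * qp (q ^ 3) (q ^ 5))

/-- Rogers–Ramanujan continued fraction product R(q). -/
noncomputable def R (q : ℂ) : ℂ :=
  (qp q (q ^ 5) * qp (q ^ 4) (q ^ 5)) / (qp (q ^ 2) (q ^ 5) * qp (q ^ 3) (q ^ 5))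

open Filter Topology

lemma summable_norm_qp {a q : ℂ} (hq : ‖q‖ < 1) : Summable fun k : ℕ ↦ ‖-(a * q ^ k)‖ := by
  simpa using (summable_geometric_of_lt_one (norm_nonneg q) hq).mul_left ‖a‖

lemma multipliable_qp {a q : ℂ} (hq : ‖q‖ < 1) : Multipliable fun k : ℕ ↦ 1 - a * q ^ k := by
  simpa [sub_eq_add_neg] using multipliable_one_add_of_summable (summable_norm_qp (a := a) hq)

lemma tendsto_qp {a q : ℂ} (hq : ‖q‖ < 1) :
    Tendsto (fun n ↦ ∏ k ∈ Finset.range n, (1 - a * q ^ k)) atTop (𝓝 (qp a q)) :=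
  (multipliable_qp hq).tendsto_prod_tprod_nat

lemma one_sub_ne_zero_of_norm_lt {z : ℂ} (hz : ‖z‖ < 1) : 1 - z ≠ 0 := by
  intro h
  rw [← sub_eq_zero.mp h, norm_one] at hz
  exact lt_irrefl _ hz

lemma one_sub_mul_pow_ne_zero {a q : ℂ} (ha : ‖a‖ < 1) (hq : ‖q‖ < 1) (k : ℕ) :
    1 - a * q ^ k ≠ 0 := by
  apply one_sub_ne_zero_of_norm_lt
  rw [norm_mul, norm_pow]
  exact mul_lt_one_of_nonneg_of_lt_one_left (norm_nonneg _) ha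
    (pow_le_one₀ (norm_nonneg _) hq.le)

lemma qp_ne_zero {a q : ℂ} (ha : ‖a‖ < 1) (hq : ‖q‖ < 1) : qp a q ≠ 0 := by
  have := tprod_one_add_ne_zero_of_summable (f := fun k : ℕ ↦ -(a * q ^ k))
    (fun k ↦ by simpa [sub_eq_add_neg] using one_sub_mul_pow_ne_zero ha hq k)
    (summable_norm_qp hq)
  simpa [qp, sub_eq_add_neg] using this

lemma norm_pow_lt_one {q : ℂ} (hq : ‖q‖ < 1) {n : ℕ} (hn : n ≠ 0) : ‖q ^ n‖ < 1 := by
  rw [norm_pow]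
  exact pow_lt_one₀ (norm_nonneg _) hq hn

/-- Splitting `(a;q)_∞` according to the residue of the index modulo `n`. -/
lemma qp_dissect {a q : ℂ} (hq : ‖q‖ < 1) {n : ℕ} (hn : n ≠ 0) :
    qp a q = ∏ i ∈ Finset.range n, qp (a * q ^ i) (q ^ n) := by
  have h1 : Tendsto (fun N ↦ ∏ k ∈ Finset.range (n * N), (1 - a * q ^ k)) atTop
      (𝓝 (qp a q)) :=
    (tendsto_qp hq).comp (tendsto_id.const_mul_atTop' (Nat.pos_of_ne_zero hn))
  have h2 : Tendsto (fun N ↦ ∏ i ∈ Finset.range n, ∏ k ∈ Finset.range N,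
      (1 - a * q ^ i * (q ^ n) ^ k)) atTop
      (𝓝 (∏ i ∈ Finset.range n, qp (a * q ^ i) (q ^ n))) :=
    tendsto_finsetProd _ fun i _ ↦ tendsto_qp (norm_pow_lt_one hq hn)
  refine tendsto_nhds_unique h1 (h2.congr fun N ↦ ?_)
  rw [Finset.prod_comm]
  induction N with
  | zero => simp
  | succ N ih =>
    rw [Finset.prod_range_succ, ih, Nat.mul_succ, Finset.prod_range_add]
    congr 1
    refine Finset.prod_congr rfl fun i _ ↦ ?_
    rw [← pow_mul, mul_assoc, ← pow_add, add_comm i]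

lemma qp_mul_qp_neg {a q : ℂ} (hq : ‖q‖ < 1) : qp a q * qp (-a) q = qp (a ^ 2) (q ^ 2) := by
  rw [qp, qp, qp, ← (multipliable_qp hq).tprod_mul (multipliable_qp hq)]
  exact tprod_congr fun k ↦ by ring

lemma E_eq_qp (q : ℂ) : E q = qp q q := by
  simp only [E, qp, pow_succ']

/-- The reciprocals `1 / (Q;Q)_k`, extended by zero to negative `k`. -/
noncomputable def invPoch (Q : ℂ) (k : ℤ) : ℂ :=
  if k < 0 then 0 else (∏ i ∈ Finset.range k.toNat, (1 - Q * Q ^ i))⁻¹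

lemma invPoch_mul {Q : ℂ} (hQ : ‖Q‖ < 1) (k : ℤ) :
    invPoch Q k * (1 - Q ^ k) = invPoch Q (k - 1) := by
  rcases lt_trichotomy k 0 with h | rfl | h
  · simp [invPoch, h, show k - 1 < 0 by omega]
  · simp [invPoch]
  · obtain ⟨n, rfl⟩ : ∃ n : ℕ, k = n + 1 := ⟨(k - 1).toNat, by omega⟩
    have h0 := one_sub_mul_pow_ne_zero hQ hQ n
    have h1 : ((n : ℤ) + 1).toNat = n + 1 := by omega
    have h2 : Q ^ ((n : ℤ) + 1) = Q * Q ^ n := by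
      rw [← pow_succ']; exact_mod_cast zpow_natCast Q (n + 1)
    have h3 : ¬ ((n : ℤ) + 1 < 0) := by omega
    rw [h2]
    simp only [invPoch, h3, if_false, h1, Finset.prod_range_succ, mul_inv, mul_assoc,
      inv_mul_cancel₀ h0, mul_one, add_sub_cancel_right, Int.toNat_natCast]
    simp

lemma tendsto_invPoch {Q : ℂ} (hQ : ‖Q‖ < 1) {f : ℕ → ℤ} (hf : Tendsto f atTop atTop) :
    Tendsto (fun n ↦ invPoch Q (f n)) atTop (𝓝 (qp Q Q)⁻¹) := by
  have h1 : Tendsto (fun n ↦ (f n).toNat) atTop atTop := by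
    refine tendsto_atTop.2 fun b ↦ ?_
    filter_upwards [hf.eventually_ge_atTop (b : ℤ)] with n hn
    omega
  refine Tendsto.congr' ?_ (((tendsto_qp hQ).inv₀ (qp_ne_zero hQ hQ)).comp h1)
  filter_upwards [hf.eventually_ge_atTop 0] with n hn
  simp [invPoch, not_lt.mpr hn]

lemma exists_norm_invPoch_le {Q : ℂ} (hQ : ‖Q‖ < 1) : ∃ C, ∀ k, ‖invPoch Q k‖ ≤ C := by
  have h := (tendsto_invPoch hQ (f := fun n : ℕ ↦ (n : ℤ)) tendsto_natCast_atTop_atTop).norm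
  obtain ⟨C, hC⟩ := h.bddAbove_range
  refine ⟨C, fun k ↦ ?_⟩
  have hn (n : ℕ) : ‖invPoch Q n‖ ≤ C := hC ⟨n, rfl⟩
  rcases lt_or_ge k 0 with hk | hk
  · simpa [invPoch, hk] using (norm_nonneg _).trans (hn 0)
  · lift k to ℕ using hk
    exact hn k

lemma summable_norm_theta_nat {t y : ℂ} (ht0 : t ≠ 0) (ht : ‖t‖ < 1) (hy : y ≠ 0) :
    Summable fun n : ℕ ↦ ‖t ^ (n ^ 2) * y ^ n‖ := by
  refine summable_of_ratio_test_tendsto_lt_one (l := 0) zero_lt_one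
    (Eventually.of_forall fun n ↦ by simp [ht0, hy]) ?_
  have h : Tendsto (fun n : ℕ ↦ (‖t‖ * ‖y‖) * (‖t‖ ^ 2) ^ n) atTop (𝓝 ((‖t‖ * ‖y‖) * 0)) :=
    (tendsto_pow_atTop_nhds_zero_of_lt_one (by positivity)
      (pow_lt_one₀ (norm_nonneg _) ht two_ne_zero)).const_mul _
  rw [mul_zero] at h
  refine h.congr fun n ↦ ?_
  have h1 : ‖t‖ ≠ 0 := by simpa
  have h2 : ‖y‖ ≠ 0 := by simpa
  simp only [norm_mul, norm_pow, norm_norm]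
  field_simp
  ring

lemma summable_norm_theta {t y : ℂ} (ht0 : t ≠ 0) (ht : ‖t‖ < 1) (hy : y ≠ 0) :
    Summable fun m : ℤ ↦ ‖t ^ (m ^ 2) * y ^ m‖ := by
  refine Summable.of_nat_of_neg ?_ ?_
  · exact_mod_cast summable_norm_theta_nat ht0 ht hy
  · refine (summable_norm_theta_nat ht0 ht (inv_ne_zero hy)).congr fun n ↦ ?_
    rw [neg_sq, zpow_neg, zpow_natCast, inv_pow]
    exact_mod_cast rfl

lemma summable_finite_theta {t y : ℂ} (ht0 : t ≠ 0) (ht : ‖t‖ < 1) (hy : y ≠ 0) (f g : ℤ → ℤ) :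
    Summable fun m : ℤ ↦ invPoch (t ^ 2) (f m) * invPoch (t ^ 2) (g m) *
      (t ^ (m ^ 2) * y ^ m) := by
  obtain ⟨C, hC⟩ := exists_norm_invPoch_le (norm_pow_lt_one ht two_ne_zero)
  refine Summable.of_norm_bounded ((summable_norm_theta ht0 ht hy).mul_left (C * C)) fun m ↦ ?_
  rw [norm_mul, norm_mul]
  have := (norm_nonneg _).trans (hC 0)
  gcongr
  · exact hC _
  · exact hC _

lemma finite_theta_term {t y : ℂ} (ht0 : t ≠ 0) (ht : ‖t‖ < 1) (hy : y ≠ 0) (n : ℕ) (m : ℤ) :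
    (1 - t ^ 2 * (t ^ 2) ^ (2 * n)) * (1 - t ^ 2 * (t ^ 2) ^ (2 * n + 1)) *
      (invPoch (t ^ 2) (n + 1 + m) * invPoch (t ^ 2) (n + 1 - m) * (t ^ (m ^ 2) * y ^ m)) =
    (1 + t ^ (4 * n + 2)) *
      (invPoch (t ^ 2) (n + m) * invPoch (t ^ 2) (n - m) * (t ^ (m ^ 2) * y ^ m)) +
    t ^ (2 * n + 1) * y * (invPoch (t ^ 2) (n + (m - 1)) * invPoch (t ^ 2) (n - (m - 1)) *
        (t ^ ((m - 1) ^ 2) * y ^ (m - 1))) +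
    t ^ (2 * n + 1) * y⁻¹ * (invPoch (t ^ 2) (n + (m + 1)) * invPoch (t ^ 2) (n - (m + 1)) *
        (t ^ ((m + 1) ^ 2) * y ^ (m + 1))) := by
  have hQ := norm_pow_lt_one ht two_ne_zero
  have hQ0 : t ^ 2 ≠ 0 := pow_ne_zero 2 ht0
  have e1 := invPoch_mul hQ (n + 1 + m)
  have e2 := invPoch_mul hQ (n + m)
  have e3 := invPoch_mul hQ (n + 1 - m)
  have e4 := invPoch_mul hQ (n - m)
  rw [show (n : ℤ) + 1 + m - 1 = n + m by ring] at e1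
  rw [show (n : ℤ) + m - 1 = n + (m - 1) by ring] at e2
  rw [show (n : ℤ) + 1 - m - 1 = n - m by ring] at e3
  rw [show (n : ℤ) - m - 1 = n - (m + 1) by ring] at e4
  rw [show (n : ℤ) + (m + 1) = n + 1 + m by ring, show (n : ℤ) - (m - 1) = n + 1 - m by ring,
    ← e2, ← e4, ← e1, ← e3]
  set α := invPoch (t ^ 2) (n + 1 + m)
  set β := invPoch (t ^ 2) (n + 1 - m)
  rw [show (m - 1) ^ 2 = m ^ 2 - (m + m) + 1 by ring, show (m + 1) ^ 2 = m ^ 2 + (m + m) + 1 by ring]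
  simp only [zpow_add₀ ht0, zpow_sub₀ ht0, zpow_add₀ hQ0, zpow_sub₀ hQ0, zpow_add₀ hy,
    zpow_sub₀ hy, zpow_one, zpow_natCast]
  have e5 : (t ^ 2) ^ m = t ^ m * t ^ m := by
    rw [pow_two, mul_zpow]
  have h5 : t ^ m ≠ 0 := zpow_ne_zero _ ht0
  rw [e5]
  generalize t ^ m = M at *
  generalize t ^ m ^ 2 = S
  generalize y ^ m = Y
  simp only [pow_add, pow_mul, pow_one, ← pow_mul t 2 n, mul_comm 2 n]
  simp only [pow_right_comm t _ n, show (4:ℕ) = 2 * 2 from rfl, ← pow_mul]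
  field_simp
  ring

lemma finite_jacobi_triple {t y : ℂ} (ht0 : t ≠ 0) (ht : ‖t‖ < 1) (hy : y ≠ 0) (n : ℕ) :
    (∏ k ∈ Finset.range (2 * n), (1 - t ^ 2 * (t ^ 2) ^ k)) *
      ∑' m : ℤ, invPoch (t ^ 2) (n + m) * invPoch (t ^ 2) (n - m) * (t ^ (m ^ 2) * y ^ m) =
    (∏ k ∈ Finset.range n, (1 - -(t * y) * (t ^ 2) ^ k)) *
      ∏ k ∈ Finset.range n, (1 - -(t * y⁻¹) * (t ^ 2) ^ k) := by
  induction n with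
  | zero =>
    rw [tsum_eq_single 0]
    · simp [invPoch]
    · intro m hm
      rcases lt_or_gt_of_ne hm with h | h <;> simp [invPoch, h]
  | succ n ih =>
    have hs := summable_finite_theta ht0 ht hy (fun m ↦ n + m) (fun m ↦ n - m)
    set F : ℤ → ℂ := fun m ↦
      invPoch (t ^ 2) (n + m) * invPoch (t ^ 2) (n - m) * (t ^ (m ^ 2) * y ^ m) with hF
    have hs1 : Summable fun m ↦ F (m - 1) := ((Equiv.subRight (1 : ℤ)).summable_iff (f := F)).2 hs
    have hs2 : Summable fun m ↦ F (m + 1) := ((Equiv.addRight (1 : ℤ)).summable_iff (f := F)).2 hs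
    have ht1 : ∑' m, F (m - 1) = ∑' m, F m := (Equiv.subRight (1 : ℤ)).tsum_eq F
    have ht2 : ∑' m, F (m + 1) = ∑' m, F m := (Equiv.addRight (1 : ℤ)).tsum_eq F
    rw [show 2 * (n + 1) = 2 * n + 1 + 1 by ring, Finset.prod_range_succ, Finset.prod_range_succ,
      Finset.prod_range_succ, Finset.prod_range_succ, mul_assoc, mul_assoc, ← tsum_mul_left,
      ← tsum_mul_left]
    have key : ∑' m : ℤ, (1 - t ^ 2 * (t ^ 2) ^ (2 * n)) * ((1 - t ^ 2 * (t ^ 2) ^ (2 * n + 1)) *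
        (invPoch (t ^ 2) ((n + 1 : ℕ) + m) * invPoch (t ^ 2) ((n + 1 : ℕ) - m) *
          (t ^ (m ^ 2) * y ^ m))) =
        (1 + t ^ (4 * n + 2) + t ^ (2 * n + 1) * y + t ^ (2 * n + 1) * y⁻¹) * ∑' m, F m := by
      rw [add_mul, add_mul]
      nth_rw 2 [← ht1]
      nth_rw 2 [← ht2]
      rw [← tsum_mul_left, ← tsum_mul_left, ← tsum_mul_left,
        ← (hs.mul_left _).tsum_add (hs1.mul_left _),
        ← ((hs.mul_left _).add (hs1.mul_left _)).tsum_add (hs2.mul_left _)]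
      refine tsum_congr fun m ↦ ?_
      rw [← mul_assoc]
      push_cast
      exact finite_theta_term ht0 ht hy n m
    rw [key, mul_left_comm, ih]
    have hyy : y * y⁻¹ = 1 := mul_inv_cancel₀ hy
    linear_combination (-t ^ 2 * (t ^ 2) ^ (2 * n) * (∏ k ∈ Finset.range n,
      (1 - -(t * y) * (t ^ 2) ^ k)) * ∏ k ∈ Finset.range n, (1 - -(t * y⁻¹) * (t ^ 2) ^ k)) * hyy

/-- The Jacobi triple product identity. -/
lemma jacobi_triple {t y : ℂ} (ht0 : t ≠ 0) (ht : ‖t‖ < 1) (hy : y ≠ 0) :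
    qp (t ^ 2) (t ^ 2) * qp (-(t * y)) (t ^ 2) * qp (-(t * y⁻¹)) (t ^ 2) =
      ∑' m : ℤ, t ^ (m ^ 2) * y ^ m := by
  have hQ := norm_pow_lt_one ht two_ne_zero
  have hP := qp_ne_zero hQ hQ
  obtain ⟨C, hC⟩ := exists_norm_invPoch_le hQ
  have hC0 := (norm_nonneg _).trans (hC 0)
  have hlim (m : ℤ) : Tendsto (fun n : ℕ ↦ invPoch (t ^ 2) (n + m) * invPoch (t ^ 2) (n - m) *
      (t ^ (m ^ 2) * y ^ m)) atTop
      (𝓝 ((qp (t ^ 2) (t ^ 2))⁻¹ * (qp (t ^ 2) (t ^ 2))⁻¹ * (t ^ (m ^ 2) * y ^ m))) :=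
    ((tendsto_invPoch hQ (tendsto_atTop_add_const_right _ m tendsto_natCast_atTop_atTop)).mul
      (tendsto_invPoch hQ
        (tendsto_atTop_add_const_right _ (-m) tendsto_natCast_atTop_atTop))).mul_const _
  have h1 := tendsto_tsum_of_dominated_convergence
    ((summable_norm_theta ht0 ht hy).mul_left (C * C)) hlim
    (Eventually.of_forall fun n m ↦ by
      rw [norm_mul, norm_mul]
      gcongr
      · exact hC _
      · exact hC _)
  have h2 := ((tendsto_qp (a := t ^ 2) hQ).comp
    (tendsto_id.const_mul_atTop' (zero_lt_two (α := ℕ)))).mul h1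
  have h3 := (tendsto_qp (a := -(t * y)) hQ).mul (tendsto_qp (a := -(t * y⁻¹)) hQ)
  have h4 := tendsto_nhds_unique h3 (h2.congr fun n ↦ finite_jacobi_triple ht0 ht hy n)
  rw [mul_assoc, h4, tsum_mul_left]
  field_simp

/-- Pairs of integers `(m, n)`, split by the parity of `m + n`. -/
lemma parity_bijective : Function.Bijective
    (Sum.elim (fun p : ℤ × ℤ ↦ (p.1 + p.2, p.1 - p.2))
      fun p : ℤ × ℤ ↦ (p.1 + p.2 + 1, p.1 - p.2)) := by
  constructor
  · rintro (⟨a, b⟩ | ⟨a, b⟩) (⟨c, d⟩ | ⟨c, d⟩) h <;>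
      simp only [Sum.elim_inl, Sum.elim_inr, Prod.mk.injEq, Sum.inl.injEq, Sum.inr.injEq,
        reduceCtorEq] at h ⊢ <;> omega
  · rintro ⟨m, n⟩
    rcases Int.even_or_odd' (m + n) with ⟨a, h | h⟩
    · exact ⟨Sum.inl (a, m - a), by simp [Prod.ext_iff]; omega⟩
    · exact ⟨Sum.inr (a, a - n), by simp [Prod.ext_iff]; omega⟩

lemma theta_mul_theta {t y w : ℂ} (ht0 : t ≠ 0) (ht : ‖t‖ < 1) (hy : y ≠ 0) (hw : w ≠ 0) :
    (∑' m : ℤ, t ^ (m ^ 2) * y ^ m) * (∑' m : ℤ, t ^ (m ^ 2) * w ^ m) =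
      (∑' m : ℤ, (t ^ 2) ^ (m ^ 2) * (y * w) ^ m) * (∑' m : ℤ, (t ^ 2) ^ (m ^ 2) * (y / w) ^ m) +
      t * y * ((∑' m : ℤ, (t ^ 2) ^ (m ^ 2) * (t ^ 2 * (y * w)) ^ m) *
        (∑' m : ℤ, (t ^ 2) ^ (m ^ 2) * (t ^ 2 * (y / w)) ^ m)) := by
  have hQ := norm_pow_lt_one ht two_ne_zero
  have hQ0 : t ^ 2 ≠ 0 := pow_ne_zero 2 ht0
  have hs {z : ℂ} (hz : z ≠ 0) := summable_norm_theta hQ0 hQ hz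
  have h1 := summable_norm_theta ht0 ht hy
  have h2 := summable_norm_theta ht0 ht hw
  have h3 := hs (mul_ne_zero hy hw)
  have h4 := hs (div_ne_zero hy hw)
  have h5 := hs (mul_ne_zero hQ0 (mul_ne_zero hy hw))
  have h6 := hs (mul_ne_zero hQ0 (div_ne_zero hy hw))
  have hsum := summable_mul_of_summable_norm h1 h2
  let e := Equiv.ofBijective _ parity_bijective
  have hsum' := e.summable_iff.2 hsum
  have hl := hsum'.comp_injective (Sum.inl_injective)
  have hr := hsum'.comp_injective (Sum.inr_injective)
  rw [tsum_mul_tsum_of_summable_norm h1 h2, tsum_mul_tsum_of_summable_norm h3 h4,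
    tsum_mul_tsum_of_summable_norm h5 h6, ← tsum_mul_left, ← e.tsum_eq]
  refine (Summable.tsum_sum hl hr).trans ?_
  congr 1 <;> refine tsum_congr fun ⟨a, b⟩ ↦ ?_
  · simp only [e, Equiv.ofBijective_apply, Function.comp_apply, Sum.elim_inl]
    rw [show (a + b) ^ 2 = a ^ 2 + b ^ 2 + 2 * (a * b) by ring,
      show (a - b) ^ 2 = a ^ 2 + b ^ 2 - 2 * (a * b) by ring]
    simp only [zpow_add₀ ht0, zpow_sub₀ ht0, zpow_add₀ hy, zpow_sub₀ hw, pow_two t, mul_zpow,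
      div_zpow]
    have := zpow_ne_zero (2 * (a * b)) ht0
    field_simp
  · simp only [e, Equiv.ofBijective_apply, Function.comp_apply, Sum.elim_inr]
    rw [show (a + b + 1) ^ 2 = a ^ 2 + b ^ 2 + 2 * (a * b) + a + b + a + b + 1 by ring,
      show (a - b) ^ 2 = a ^ 2 + b ^ 2 - 2 * (a * b) by ring]
    simp only [zpow_add₀ ht0, zpow_sub₀ ht0, zpow_add₀ hy, zpow_sub₀ hw, pow_two t, mul_zpow,
      div_zpow, zpow_one]
    have := zpow_ne_zero (2 * (a * b)) ht0
    field_simp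

/-- The addition formula for products of theta functions, in product form. -/
lemma qp_addition {Q x x' w w' u v : ℂ} (hQ0 : Q ≠ 0) (hQ : ‖Q‖ < 1) (hx : x * x' = Q)
    (hw : w * w' = Q) (hu : u * (x * w) = Q) (hv : v * x = w) :
    qp Q Q ^ 2 * (qp x Q * qp x' Q * (qp w Q * qp w' Q)) =
      qp (Q ^ 2) (Q ^ 2) ^ 2 *
        (qp (-(x * w)) (Q ^ 2) * qp (-(x' * w')) (Q ^ 2) *
          (qp (-(x * w')) (Q ^ 2) * qp (-(x' * w)) (Q ^ 2)) -
        x * (qp (-(Q * (x * w))) (Q ^ 2) * qp (-u) (Q ^ 2) *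
          (qp (-(Q * (x * w'))) (Q ^ 2) * qp (-v) (Q ^ 2)))) := by
  obtain ⟨t, rfl⟩ : ∃ t, Q = t ^ 2 := (IsAlgClosed.exists_pow_nat_eq Q two_pos).imp fun _ h ↦ h.symm
  have ht0 : t ≠ 0 := by rintro rfl; simp at hQ0
  have ht : ‖t‖ < 1 := by
    rw [norm_pow] at hQ
    exact (pow_lt_one_iff_of_nonneg (norm_nonneg _) two_ne_zero).1 hQ
  have hx0 : x ≠ 0 := left_ne_zero_of_mul (hx.trans_ne hQ0)
  have hw0 : w ≠ 0 := left_ne_zero_of_mul (hw.trans_ne hQ0)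
  have hx' : x' = t ^ 2 / x := by field_simp; linear_combination hx
  have hw' : w' = t ^ 2 / w := by field_simp; linear_combination hw
  have hu' : u = t ^ 2 / (x * w) := by field_simp; linear_combination hu
  have hv' : v = w / x := by field_simp; linear_combination hv
  subst hx' hw' hu' hv'
  have key {s z : ℂ} (hs0 : s ≠ 0) (hs : ‖s‖ < 1) (hz : z ≠ 0) (a b : ℂ) (ha : a = -(s * z))
      (hb : b = -(s * z⁻¹)) :
      qp (s ^ 2) (s ^ 2) * (qp a (s ^ 2) * qp b (s ^ 2)) = ∑' m : ℤ, s ^ (m ^ 2) * z ^ m := by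
    rw [ha, hb, ← mul_assoc, jacobi_triple hs0 hs hz]
  have hy : -(x / t) ≠ 0 := by simp [hx0, ht0]
  have hz : -(w / t) ≠ 0 := by simp [hw0, ht0]
  have h := theta_mul_theta ht0 ht hy hz
  rw [← key ht0 ht hy x (t ^ 2 / x) (by field_simp) (by field_simp),
    ← key ht0 ht hz w (t ^ 2 / w) (by field_simp) (by field_simp),
    ← key hQ0 hQ (mul_ne_zero hy hz) (-(x * w)) (-(t ^ 2 / x * (t ^ 2 / w)))
      (by field_simp) (by field_simp),
    ← key hQ0 hQ (div_ne_zero hy hz) (-(x * (t ^ 2 / w))) (-(t ^ 2 / x * w))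
      (by field_simp) (by field_simp),
    ← key hQ0 hQ (mul_ne_zero hQ0 (mul_ne_zero hy hz)) (-(t ^ 2 * (x * w))) (-(t ^ 2 / (x * w)))
      (by field_simp) (by field_simp),
    ← key hQ0 hQ (mul_ne_zero hQ0 (div_ne_zero hy hz)) (-(t ^ 2 * (x * (t ^ 2 / w)))) (-(w / x))
      (by field_simp) (by field_simp)] at h
  have hxt : t * -(x / t) = -x := by field_simp
  rw [hxt] at h
  linear_combination h

lemma level_ten_algebra {q X Y A B P P₂ : ℂ} (hY : Y ≠ 0) (hA : A ≠ 0) (hB : B ≠ 0) (hP : P ≠ 0)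
    (hs : P ^ 2 * (A ^ 2 * Y) = P₂ ^ 2 * (X * B * (Y * B + q * (A * X))))
    (hd : P ^ 2 * (X * B ^ 2) = P₂ ^ 2 * (A * Y * (Y * B - q * (A * X)))) :
    A / B - (X * B / (A * Y)) ^ 2 =
        q * (X * B / (A * Y)) * (A / B) ^ 2 * (A / B + (X * B / (A * Y)) ^ 2) ∧
      (A / B) ^ 2 - (X * B / (A * Y)) ^ 4 =
        4 * q * (X * Y * P₂ ^ 4 / P ^ 4) * ((X * B / (A * Y)) ^ 2 * (A / B)) := by
  have hsub : P ^ 2 * (A ^ 3 * Y ^ 2 - X ^ 2 * B ^ 3) =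
      P₂ ^ 2 * (X * A * B * Y * (2 * q * A * X)) := by
    linear_combination A * Y * hs - X * B * hd
  have hadd : P ^ 2 * (A ^ 3 * Y ^ 2 + X ^ 2 * B ^ 3) =
      P₂ ^ 2 * (X * A * B * Y * (2 * Y * B)) := by
    linear_combination A * Y * hs + X * B * hd
  constructor
  · have h : Y * B * (A ^ 3 * Y ^ 2 - X ^ 2 * B ^ 3) =
        q * X * A * (A ^ 3 * Y ^ 2 + X ^ 2 * B ^ 3) := by
      apply mul_left_cancel₀ (pow_ne_zero 2 hP)
      linear_combination Y * B * hsub - q * X * A * hadd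
    field_simp
    linear_combination h
  · have h : P ^ 4 * ((A ^ 3 * Y ^ 2 - X ^ 2 * B ^ 3) * (A ^ 3 * Y ^ 2 + X ^ 2 * B ^ 3)) =
        4 * q * P₂ ^ 4 * X ^ 3 * A ^ 3 * B ^ 3 * Y ^ 3 := by
      linear_combination P ^ 2 * (A ^ 3 * Y ^ 2 + X ^ 2 * B ^ 3) * hsub +
        P₂ ^ 2 * (X * A * B * Y * (2 * q * A * X)) * hadd
    field_simp
    linear_combination h

/-- The modular equation relating `R(q)` and `R(q²)`, and the eta quotient attached to it. -/
lemma R_level_ten {q : ℂ} (hq0 : q ≠ 0) (hq : ‖q‖ < 1) :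
    R (q ^ 2) - R q ^ 2 = q * R q * R (q ^ 2) ^ 2 * (R (q ^ 2) + R q ^ 2) ∧
      R (q ^ 2) ^ 2 - R q ^ 4 =
        4 * q * (E q * E (q ^ 10) ^ 5 / (E (q ^ 2) * E (q ^ 5) ^ 5)) * (R q ^ 2 * R (q ^ 2)) := by
  have hn {n : ℕ} (h : n ≠ 0) := norm_pow_lt_one hq h
  have h5 : ‖q ^ 5‖ < 1 := hn (by norm_num)
  have h10 : ‖q ^ 10‖ < 1 := hn (by norm_num)
  have hd0 (i : ℕ) (hi : i ≠ 0) : qp (q ^ i) (q ^ 10) ≠ 0 := qp_ne_zero (hn hi) h10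
  have split (i : ℕ) : qp (q ^ i) (q ^ 5) = qp (q ^ i) (q ^ 10) * qp (q ^ (i + 5)) (q ^ 10) := by
    rw [qp_dissect h5 two_ne_zero]
    simp [Finset.prod_range_succ, ← pow_mul, ← pow_add]
  have dbl (i : ℕ) : qp (q ^ i) (q ^ 5) * qp (-q ^ i) (q ^ 5) = qp (q ^ (2 * i)) (q ^ 10) := by
    rw [qp_mul_qp_neg h5, ← pow_mul, ← pow_mul, mul_comm i]
  have hR1 : R q = qp (q ^ 1) (q ^ 10) * qp (q ^ 9) (q ^ 10) *
      (qp (q ^ 4) (q ^ 10) * qp (q ^ 6) (q ^ 10)) /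
      (qp (q ^ 2) (q ^ 10) * qp (q ^ 8) (q ^ 10) *
        (qp (q ^ 3) (q ^ 10) * qp (q ^ 7) (q ^ 10))) := by
    have := split 1
    rw [pow_one] at this
    rw [R, this, split 2, split 3, split 4, pow_one]
    norm_num only
    congr 1 <;> ring
  have hR2 : R (q ^ 2) = qp (q ^ 2) (q ^ 10) * qp (q ^ 8) (q ^ 10) /
      (qp (q ^ 4) (q ^ 10) * qp (q ^ 6) (q ^ 10)) := by
    simp only [R, ← pow_mul]
  have hP : qp (q ^ 5) (q ^ 5) ≠ 0 := qp_ne_zero h5 h5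
  have hE : E q * E (q ^ 10) ^ 5 / (E (q ^ 2) * E (q ^ 5) ^ 5) =
      qp (q ^ 1) (q ^ 10) * qp (q ^ 9) (q ^ 10) * (qp (q ^ 3) (q ^ 10) * qp (q ^ 7) (q ^ 10)) *
        qp (q ^ 10) (q ^ 10) ^ 4 / qp (q ^ 5) (q ^ 5) ^ 4 := by
    have e1 : E q = ∏ i ∈ Finset.range 10, qp (q ^ (i + 1)) (q ^ 10) := by
      rw [E_eq_qp, qp_dissect hq (by norm_num : 10 ≠ 0)]
      simp only [pow_succ']
    have e2 : E (q ^ 2) = ∏ i ∈ Finset.range 5, qp (q ^ (2 * i + 2)) (q ^ 10) := by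
      rw [E_eq_qp, qp_dissect (hn two_ne_zero) (by norm_num : 5 ≠ 0)]
      simp only [← pow_mul, ← pow_add, add_comm 2]
    simp only [Finset.prod_range_succ, Finset.prod_range_zero, one_mul] at e1 e2
    norm_num only at e1 e2
    have e5 := split 5
    norm_num only at e5
    have := hd0 2 (by norm_num)
    have := hd0 4 (by norm_num)
    have := hd0 5 (by norm_num)
    have := hd0 6 (by norm_num)
    have := hd0 8 (by norm_num)
    have := hd0 10 (by norm_num)
    rw [E_eq_qp (q ^ 10), E_eq_qp (q ^ 5), e1, e2, e5]
    field_simp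
  have hS := qp_addition (x := -q ^ 1) (x' := -q ^ 4) (w := q ^ 2) (w' := q ^ 3) (u := -q ^ 2)
    (v := -q ^ 1) (pow_ne_zero 5 hq0) h5 (by ring) (by ring) (by ring) (by ring)
  have hD := qp_addition (x := q ^ 1) (x' := q ^ 4) (w := -q ^ 2) (w' := -q ^ 3) (u := -q ^ 2)
    (v := -q ^ 1) (pow_ne_zero 5 hq0) h5 (by ring) (by ring) (by ring) (by ring)
  simp only [neg_mul, mul_neg, neg_neg, ← pow_add, ← pow_mul] at hS hD
  norm_num only at hS hD
  have b1 := dbl 1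
  have b2 := dbl 2
  have b3 := dbl 3
  have b4 := dbl 4
  rw [split] at b1 b2 b3 b4
  rw [split 2, split 3] at hS
  rw [split 1, split 4] at hD
  norm_num only at hS hD b1 b2 b3 b4
  rw [hR1, hR2, hE]
  have d1 := hd0 1 (by norm_num)
  have d2 := hd0 2 (by norm_num)
  have d3 := hd0 3 (by norm_num)
  have d4 := hd0 4 (by norm_num)
  have d6 := hd0 6 (by norm_num)
  have d7 := hd0 7 (by norm_num)
  have d8 := hd0 8 (by norm_num)
  have d9 := hd0 9 (by norm_num)
  have n1 := eq_div_of_mul_eq (by positivity) ((mul_comm _ _).trans b1)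
  have n2 := eq_div_of_mul_eq (by positivity) ((mul_comm _ _).trans b2)
  have n3 := eq_div_of_mul_eq (by positivity) ((mul_comm _ _).trans b3)
  have n4 := eq_div_of_mul_eq (by positivity) ((mul_comm _ _).trans b4)
  rw [n1, n4] at hS
  rw [n2, n3] at hD
  simp only [pow_one] at hS hD d1 ⊢
  refine level_ten_algebra (by positivity) (by positivity) (by positivity) hP ?_ ?_
  · field_simp at hS ⊢
    linear_combination hS
  · field_simp at hD ⊢
    linear_combination hD

lemma differentiableOn_qp_pow (i : ℕ) {n : ℕ} (hn : n ≠ 0) :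
    DifferentiableOn ℂ (fun z ↦ qp (z ^ i) (z ^ n)) (Metric.ball 0 1) := by
  intro z hz
  rw [mem_ball_zero_iff] at hz
  obtain ⟨r, hzr, hr⟩ := exists_between hz
  have hr0 : 0 ≤ r := (norm_nonneg z).trans hzr.le
  have h := Summable.hasProdLocallyUniformlyOn_nat_one_add (K := Metric.ball (0 : ℂ) r)
    (f := fun k z ↦ -(z ^ i * (z ^ n) ^ k)) Metric.isOpen_ball
    (u := fun k ↦ (r ^ n) ^ k)
    (summable_geometric_of_lt_one (by positivity) (pow_lt_one₀ hr0 hr hn))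
    (Eventually.of_forall fun k x hx ↦ by
      rw [mem_ball_zero_iff] at hx
      rw [norm_neg, norm_mul, norm_pow, norm_pow, norm_pow]
      have h1 : ‖x‖ ^ i ≤ 1 := pow_le_one₀ (norm_nonneg _) (hx.trans hr).le
      have h2 : (‖x‖ ^ n) ^ k ≤ (r ^ n) ^ k := by gcongr
      calc _ ≤ 1 * (‖x‖ ^ n) ^ k := by gcongr
        _ ≤ _ := by rwa [one_mul])
    (fun k ↦ by fun_prop)
  have hd := h.differentiableOn (.of_forall fun s ↦ by
    simpa [Finset.prod_fn] using DifferentiableOn.finsetProd (fun _ _ ↦ by fun_prop))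
    Metric.isOpen_ball
  have hd' : DifferentiableAt ℂ (fun z ↦ qp (z ^ i) (z ^ n)) z := by
    simpa [qp, sub_eq_add_neg] using
      hd.differentiableAt (Metric.isOpen_ball.mem_nhds (mem_ball_zero_iff.2 hzr))
  exact hd'.differentiableWithinAt

lemma R_ne_zero {q : ℂ} (hq : ‖q‖ < 1) : R q ≠ 0 := by
  have h5 := norm_pow_lt_one hq (by norm_num : 5 ≠ 0)
  have hn {n : ℕ} (h : n ≠ 0) := qp_ne_zero (norm_pow_lt_one hq h) h5
  exact div_ne_zero (mul_ne_zero (qp_ne_zero hq h5) (hn (by norm_num)))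
    (mul_ne_zero (hn (by norm_num)) (hn (by norm_num)))

lemma R_zero : R 0 = 1 := by
  simp [R, qp]

lemma differentiableOn_R : DifferentiableOn ℂ R (Metric.ball 0 1) := by
  have hd (i : ℕ) := differentiableOn_qp_pow i (by norm_num : 5 ≠ 0)
  have h1 := hd 1
  simp only [pow_one] at h1
  refine (h1.mul (hd 4)).fun_div ((hd 2).mul (hd 3))
    fun z hz ↦ ?_
  rw [mem_ball_zero_iff] at hz
  have h5 := norm_pow_lt_one hz (by norm_num : 5 ≠ 0)
  exact mul_ne_zero (qp_ne_zero (norm_pow_lt_one hz (by norm_num)) h5)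
    (qp_ne_zero (norm_pow_lt_one hz (by norm_num)) h5)

/-- Ramanujan's parameter `k(q) = q R(q) R(q²)²`. -/
noncomputable def ramanujanK (q : ℂ) : ℂ := q * R q * R (q ^ 2) ^ 2

lemma differentiableOn_comp_sq {f : ℂ → ℂ} (hf : DifferentiableOn ℂ f (Metric.ball 0 1)) :
    DifferentiableOn ℂ (fun z ↦ f (z ^ 2)) (Metric.ball 0 1) :=
  hf.comp (by fun_prop) fun z hz ↦ by
    rw [mem_ball_zero_iff] at hz ⊢
    exact norm_pow_lt_one hz two_ne_zero

lemma differentiableOn_ramanujanK : DifferentiableOn ℂ ramanujanK (Metric.ball 0 1) :=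
  (differentiableOn_id.mul differentiableOn_R).mul
    ((differentiableOn_comp_sq differentiableOn_R).pow 2)

lemma ramanujanK_zero : ramanujanK 0 = 0 := by
  simp [ramanujanK]

lemma R_sq_relation {q : ℂ} (hq0 : q ≠ 0) (hq : ‖q‖ < 1) :
    R (q ^ 2) * (1 - ramanujanK q) = R q ^ 2 * (1 + ramanujanK q) := by
  have h := (R_level_ten hq0 hq).1
  rw [ramanujanK]
  linear_combination h

lemma ramanujanK_mul_eq_zero {q : ℂ} (hq : ‖q‖ < 1) :
    (ramanujanK q ^ 2 - ramanujanK (q ^ 2) + 2 * ramanujanK q * ramanujanK (q ^ 2) +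
      ramanujanK q ^ 2 * ramanujanK (q ^ 2) + ramanujanK (q ^ 2) ^ 2) *
      (1 + ramanujanK q - ramanujanK (q ^ 2) + ramanujanK q * ramanujanK (q ^ 2)) = 0 := by
  rcases eq_or_ne q 0 with rfl | hq0
  · simp [ramanujanK_zero]
  have h1 := R_sq_relation hq0 hq
  have h2 := R_sq_relation (pow_ne_zero 2 hq0) (norm_pow_lt_one hq two_ne_zero)
  have hk : ramanujanK q ^ 2 = q ^ 2 * R q ^ 2 * R (q ^ 2) ^ 4 := by rw [ramanujanK]; ring
  have hk' : ramanujanK (q ^ 2) = q ^ 2 * R (q ^ 2) * R ((q ^ 2) ^ 2) ^ 2 := by rw [ramanujanK]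
  have e1 : ramanujanK q ^ 2 * (1 + ramanujanK q) =
      q ^ 2 * R (q ^ 2) ^ 5 * (1 - ramanujanK q) := by
    linear_combination (1 + ramanujanK q) * hk - q ^ 2 * R (q ^ 2) ^ 4 * h1
  have e2 : ramanujanK (q ^ 2) * (1 - ramanujanK (q ^ 2)) ^ 2 =
      q ^ 2 * R (q ^ 2) ^ 5 * (1 + ramanujanK (q ^ 2)) ^ 2 := by
    linear_combination (1 - ramanujanK (q ^ 2)) ^ 2 * hk' +
      q ^ 2 * R (q ^ 2) * (R ((q ^ 2) ^ 2) * (1 - ramanujanK (q ^ 2)) +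
        R (q ^ 2) ^ 2 * (1 + ramanujanK (q ^ 2))) * h2
  linear_combination (1 + ramanujanK (q ^ 2)) ^ 2 * e1 - (1 - ramanujanK q) * e2

lemma ramanujanK_relation {q : ℂ} (hq : ‖q‖ < 1) :
    ramanujanK q ^ 2 - ramanujanK (q ^ 2) + 2 * ramanujanK q * ramanujanK (q ^ 2) +
      ramanujanK q ^ 2 * ramanujanK (q ^ 2) + ramanujanK (q ^ 2) ^ 2 = 0 := by
  have hd := differentiableOn_ramanujanK
  have hd2 := differentiableOn_comp_sq hd
  have hF : DifferentiableOn ℂ (fun q ↦ ramanujanK q ^ 2 - ramanujanK (q ^ 2) +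
      2 * ramanujanK q * ramanujanK (q ^ 2) + ramanujanK q ^ 2 * ramanujanK (q ^ 2) +
      ramanujanK (q ^ 2) ^ 2) (Metric.ball 0 1) := by fun_prop
  have hS : DifferentiableOn ℂ (fun q ↦ 1 + ramanujanK q - ramanujanK (q ^ 2) +
      ramanujanK q * ramanujanK (q ^ 2)) (Metric.ball 0 1) := by fun_prop
  have hmem : Metric.ball (0 : ℂ) 1 ∈ 𝓝 0 := Metric.ball_mem_nhds _ one_pos
  refine (hF.analyticOnNhd Metric.isOpen_ball).eqOn_zero_of_preconnected_of_eventuallyEq_zero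
    (convex_ball (0 : ℂ) 1).isPreconnected (Metric.mem_ball_self one_pos) ?_
    (mem_ball_zero_iff.2 hq)
  have hne := (hS.differentiableAt hmem).continuousAt.eventually_ne (y := 0)
    (by simp [ramanujanK_zero])
  filter_upwards [hne, hmem] with z hz hz1
  exact (mul_eq_zero.1 (ramanujanK_mul_eq_zero (mem_ball_zero_iff.1 hz1))).resolve_right hz

theorem stmt_14 : ∀ q : ℂ, ‖q‖ < 1 →
    R (q ^ 4) / (R q ^ 2 * R (q ^ 2)) + R q ^ 2 * R (q ^ 2) / R (q ^ 4)
      = 2 + 4 * q ^ 2 * E (q ^ 2) * E (q ^ 20) ^ 5 / (E (q ^ 4) * E (q ^ 10) ^ 5) := by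
  intro q hq
  rcases eq_or_ne q 0 with rfl | hq0
  · norm_num [R_zero]
  have hq2 := norm_pow_lt_one hq two_ne_zero
  have hu := R_ne_zero hq
  have hv := R_ne_zero hq2
  have hw := R_ne_zero (norm_pow_lt_one hq four_ne_zero)
  have h1 := R_sq_relation hq0 hq
  have h2 := R_sq_relation (pow_ne_zero 2 hq0) hq2
  have h3 := (R_level_ten (pow_ne_zero 2 hq0) hq2).2
  have hF := ramanujanK_relation hq
  rw [show 4 * q ^ 2 * E (q ^ 2) * E (q ^ 20) ^ 5 / (E (q ^ 4) * E (q ^ 10) ^ 5) =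
    4 * q ^ 2 * (E (q ^ 2) * E (q ^ 20) ^ 5 / (E (q ^ 4) * E (q ^ 10) ^ 5)) by ring]
  simp only [← pow_mul] at h2 h3
  norm_num only at h2 h3
  generalize E (q ^ 2) * E (q ^ 20) ^ 5 / (E (q ^ 4) * E (q ^ 10) ^ 5) = e at *
  generalize R q = u at *
  generalize R (q ^ 2) = v at *
  generalize R (q ^ 4) = w at *
  generalize ramanujanK q = k at *
  generalize ramanujanK (q ^ 2) = l at *
  have ne {a b c : ℂ} (ha : a ≠ 0) (hb : b ≠ 0) (h : a * (1 - c) = b ^ 2 * (1 + c)) :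
      1 - c ≠ 0 ∧ 1 + c ≠ 0 := by
    constructor <;> intro hc
    · rw [hc, mul_zero, zero_eq_mul, or_iff_right (pow_ne_zero 2 hb)] at h
      exact two_ne_zero (α := ℂ) (by linear_combination hc + h)
    · rw [hc, mul_zero, mul_eq_zero, or_iff_right ha] at h
      exact two_ne_zero (α := ℂ) (by linear_combination hc + h)
  obtain ⟨hk1, hk2⟩ := ne hv hu h1
  obtain ⟨hl1, hl2⟩ := ne hw hv h2
  have he : 4 * q ^ 2 * e = w / v ^ 2 - v ^ 2 / w := by
    field_simp
    linear_combination -h3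
  have hα : u ^ 2 = v * ((1 - k) / (1 + k)) := by
    field_simp
    linear_combination -h1
  have hβ : v ^ 2 = w * ((1 - l) / (1 + l)) := by
    field_simp
    linear_combination -h2
  have hX : u ^ 2 * v = w * ((1 - l) / (1 + l) * ((1 - k) / (1 + k))) := by
    rw [hα, ← mul_assoc w, ← hβ]
    ring
  rw [he, hX, hβ]
  field_simp
  linear_combination 4 * hF
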